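/- arXiv:1610.07754 — 8 statements merged into one kernel-verified Lean document; each statement's English description precedes it below -/
import Mathlib

section
/- There exists a social network (a finite directed graph with nonnegative activity weights) together with a live-edge distribution μ concentrated on a single subgraph g ⊆ E (deterministic diffusion) for which the activity function δ_A is not supermodular; concretely, there exist sets M ⊆ N ⊆ V and a vertex v ∉ N with δ_A(M ∪ {v}) − δ_A(M) > δ_A(N ∪ {v}) − δ_A(N). -/
open scoped Classical
open Finset

noncomputable section

/-- `rch g S v` : vertex `v` is reachable from the seed set `S` along edges of `g`. -/
def rch {V : Type*} (g : Finset (V × V)) (S : Finset V) (v : V) : Prop :=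
  ∃ u ∈ S, Relation.ReflTransGen (fun a b => (a, b) ∈ g) u v

/-- The activity `δ_A(S)` of a seed set `S`, for live-edge distribution `μ`. -/
def deltaA {V : Type*} (E : Finset (V × V)) (A : V × V → ℝ)
    (μ : Finset (V × V) → ℝ) (S : Finset V) : ℝ :=
  ∑ g ∈ E.powerset, μ g *
    ∑ e ∈ E.filter (fun e => rch g S e.1 ∧ rch g S e.2), A e

theorem not_rch_empty {V : Type*} (g : Finset (V × V)) (v : V) : ¬ rch g ∅ v := by
  simp [rch]

/-- The edge set of the complete loopless digraph on `V`. -/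
def completeEdges (V : Type*) [Fintype V] : Finset (V × V) := univ.offDiag

theorem mem_completeEdges {V : Type*} [Fintype V] {e : V × V} :
    e ∈ completeEdges V ↔ e.1 ≠ e.2 := by
  simp [completeEdges]

/-- In the complete loopless digraph, every vertex is reachable from a nonempty seed set. -/
theorem rch_completeEdges {V : Type*} [Fintype V] {S : Finset V} (hS : S.Nonempty) (v : V) :
    rch (completeEdges V) S v := by
  obtain ⟨u, hu⟩ := hS
  refine ⟨u, hu, ?_⟩
  by_cases h : u = v
  · exact h ▸ Relation.ReflTransGen.refl
  · exact Relation.ReflTransGen.single (mem_completeEdges.2 h)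

/-- The activity under diffusion that is deterministically along `g`. -/
theorem deltaA_single {V : Type*} {E g : Finset (V × V)} (hg : g ⊆ E) (A : V × V → ℝ)
    (S : Finset V) :
    deltaA E A (Set.indicator {g} 1) S = ∑ e ∈ E with rch g S e.1 ∧ rch g S e.2, A e := by
  rw [deltaA, Finset.sum_eq_single_of_mem g (mem_powerset.2 hg)]
  · simp
  · intro g' _ h
    simp [h]

theorem deltaA_empty {V : Type*} (E : Finset (V × V)) (A : V × V → ℝ)
    (μ : Finset (V × V) → ℝ) : deltaA E A μ ∅ = 0 := by
  simp [deltaA, not_rch_empty]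

theorem deltaA_completeEdges {V : Type*} [Fintype V] (A : V × V → ℝ) {S : Finset V}
    (hS : S.Nonempty) :
    deltaA (completeEdges V) A (Set.indicator {completeEdges V} 1) S =
      ∑ e ∈ completeEdges V, A e := by
  rw [deltaA_single Subset.rfl, filter_true_of_mem fun e _ =>
    ⟨rch_completeEdges hS e.1, rch_completeEdges hS e.2⟩]

/-- There is a social network with a deterministic live-edge distribution
(concentrated on a single subgraph `g`) whose activity function is not supermodular. -/
theorem activity_not_supermodular :
    ∃ (V : Type) (_ : Fintype V) (E : Finset (V × V)) (A : V × V → ℝ)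
      (μ : Finset (V × V) → ℝ) (g : Finset (V × V)) (M N : Finset V) (v : V),
      (∀ e ∈ E, 0 ≤ A e) ∧ (∀ e ∉ E, A e = 0) ∧
      g ⊆ E ∧ μ g = 1 ∧ (∀ g' ∈ E.powerset, g' ≠ g → μ g' = 0) ∧
      M ⊆ N ∧ v ∉ N ∧
      deltaA E A μ (M ∪ {v}) - deltaA E A μ M >
        deltaA E A μ (N ∪ {v}) - deltaA E A μ N := by
  refine ⟨Bool, inferInstance, completeEdges Bool, fun e => if e.1 ≠ e.2 then 1 else 0,
    Set.indicator {completeEdges Bool} 1, completeEdges Bool, ∅, {true}, false,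
    ?_, ?_, Subset.rfl, ?_, ?_,
    empty_subset _, by simp, ?_⟩
  · intro e _
    positivity
  · intro e he
    simpa [mem_completeEdges] using he
  · simp
  · intro g' _ h
    simp [h]
  · rw [deltaA_empty, deltaA_completeEdges _ ⟨false, by simp⟩,
      deltaA_completeEdges _ ⟨false, by simp⟩,
      deltaA_completeEdges _ ⟨true, by simp⟩, sub_self, sub_zero]
    refine sum_pos (fun e he => ?_) ⟨(true, false), by simp [mem_completeEdges]⟩
    rw [if_pos (mem_completeEdges.1 he)]
    exact one_pos
end
end

section
/- Fix any subgraph g ⊆ E. The set function Q(S) = Σ_{(u,v)∈E such that ∃x∈S with u∈R_g({x}) and v∈R_g({x})} A(u,v) is submodular: for all M ⊆ N ⊆ V and v ∉ N, Q(M ∪ {v}) − Q(M) ≥ Q(N ∪ {v}) − Q(N). -/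
open scoped Classical
open Finset

noncomputable section

/-- `Q(S)` : total activity of the edges whose two endpoints are reachable in `g`
from the same seed node of `S`. -/
def Q {V : Type*} (E : Finset (V × V)) (A : V × V → ℝ)
    (g : Finset (V × V)) (S : Finset V) : ℝ :=
  ∑ e ∈ E.filter (fun e => ∃ x ∈ S, rch g {x} e.1 ∧ rch g {x} e.2), A e

/-- For any fixed subgraph `g ⊆ E`, the function `Q` is submodular. -/
theorem Q_submodular {V : Type*} [Fintype V]
    (E : Finset (V × V)) (A : V × V → ℝ)
    (hA : ∀ e ∈ E, 0 ≤ A e) (hA0 : ∀ e ∉ E, A e = 0)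
    (g : Finset (V × V)) (hg : g ⊆ E)
    (M N : Finset V) (hMN : M ⊆ N) (v : V) (hv : v ∉ N) :
    Q E A g (M ∪ {v}) - Q E A g M ≥ Q E A g (N ∪ {v}) - Q E A g N := by
  simp only [Q, Finset.sum_filter, ge_iff_le, ← Finset.sum_sub_distrib]
  refine Finset.sum_le_sum fun e he => ?_
  have hmono : (∃ x ∈ M, rch g {x} e.1 ∧ rch g {x} e.2) →
      ∃ x ∈ N, rch g {x} e.1 ∧ rch g {x} e.2 :=
    fun ⟨x, hx, h⟩ => ⟨x, hMN hx, h⟩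
  have hinsert (S : Finset V) : (∃ x ∈ S ∪ {v}, rch g {x} e.1 ∧ rch g {x} e.2) ↔
      (∃ x ∈ S, rch g {x} e.1 ∧ rch g {x} e.2) ∨ (rch g {v} e.1 ∧ rch g {v} e.2) := by
    simp only [Finset.mem_union, Finset.mem_singleton, or_and_right, exists_or, exists_eq_left]
  have hA_nonneg := hA e he
  simp only [hinsert]
  split_ifs <;> grind
end
end

section
/- The lower bound δ_L is submodular: for all M ⊆ N ⊆ V and all v ∉ N, δ_L(M ∪ {v}) − δ_L(M) ≥ δ_L(N ∪ {v}) − δ_L(N). -/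
open scoped Classical
open Finset

noncomputable section

/-- The lower bound `δ_L(S)`: only edges whose two endpoints are reachable
from the same seed node are counted. -/
def deltaL {V : Type*} (E : Finset (V × V)) (A : V × V → ℝ)
    (μ : Finset (V × V) → ℝ) (S : Finset V) : ℝ :=
  ∑ g ∈ E.powerset, μ g *
    ∑ e ∈ E.filter (fun e => ∃ x ∈ S, rch g {x} e.1 ∧ rch g {x} e.2), A e

/-- Weighted coverage is submodular. -/
theorem sum_filter_exists_submodular {V ι : Type*} (E : Finset ι) (A : ι → ℝ)
    (hA : ∀ e ∈ E, 0 ≤ A e) (P : V → ι → Prop) {M N : Finset V} (hMN : M ⊆ N) (v : V) :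
    ∑ e ∈ E with ∃ x ∈ N ∪ {v}, P x e, A e - ∑ e ∈ E with ∃ x ∈ N, P x e, A e ≤
      ∑ e ∈ E with ∃ x ∈ M ∪ {v}, P x e, A e - ∑ e ∈ E with ∃ x ∈ M, P x e, A e := by
  simp only [Finset.sum_filter, ← Finset.sum_sub_distrib]
  refine Finset.sum_le_sum fun e he => ?_
  have hAe := hA e he
  have hmono : (∃ x ∈ M, P x e) → ∃ x ∈ N, P x e := fun ⟨x, hx, h⟩ => ⟨x, hMN hx, h⟩
  have hunion (S : Finset V) : (∃ x ∈ S ∪ {v}, P x e) ↔ (∃ x ∈ S, P x e) ∨ P v e := by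
    simp only [Finset.mem_union, Finset.mem_singleton, or_and_right, exists_or, exists_eq_left]
  simp only [hunion]
  by_cases hM : ∃ x ∈ M, P x e
  · simp only [hM, hmono hM, true_or, if_true, le_refl]
  · by_cases hN : ∃ x ∈ N, P x e <;> by_cases hv : P v e <;>
      simp only [hM, hN, hv, or_true, or_false, if_true, if_false] <;> linarith

/-- The lower bound `δ_L` is submodular. -/
theorem deltaL_submodular {V : Type*} [Fintype V]
    (E : Finset (V × V)) (A : V × V → ℝ) (μ : Finset (V × V) → ℝ)
    (hA : ∀ e ∈ E, 0 ≤ A e) (hA0 : ∀ e ∉ E, A e = 0)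
    (hμ : ∀ g ∈ E.powerset, 0 ≤ μ g) (hμ1 : ∑ g ∈ E.powerset, μ g = 1)
    (M N : Finset V) (hMN : M ⊆ N) (v : V) (hv : v ∉ N) :
    deltaL E A μ (M ∪ {v}) - deltaL E A μ M ≥
      deltaL E A μ (N ∪ {v}) - deltaL E A μ N := by
  simp only [deltaL, ge_iff_le, ← Finset.sum_sub_distrib, ← mul_sub]
  refine Finset.sum_le_sum fun g hg => mul_le_mul_of_nonneg_left ?_ (hμ g hg)
  change (_ : ℝ) ≤ _
  convert sum_filter_exists_submodular E A hA
    (fun x e => rch g {x} e.1 ∧ rch g {x} e.2) hMN v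
end
end

section
/- Fix any subgraph g ⊆ E and any nonnegative vertex weights c : V → ℝ. The set function Q'(S) = Σ_{v∈R_g(S)} c(v) is submodular: for all M ⊆ N ⊆ V and v ∉ N, Q'(M ∪ {v}) − Q'(M) ≥ Q'(N ∪ {v}) − Q'(N). -/
open scoped Classical
open Finset

noncomputable section

/-- The set of vertices reachable from the seed set `S` along edges of `g`. -/
def reach {V : Type*} [Fintype V] (g : Finset (V × V)) (S : Finset V) : Finset V :=
  Finset.univ.filter fun v => ∃ u ∈ S, Relation.ReflTransGen (fun a b => (a, b) ∈ g) u v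

/-- `Q'(S)` : total weight of the vertices reachable from `S` in `g`. -/
def Q' {V : Type*} [Fintype V] (g : Finset (V × V)) (c : V → ℝ) (S : Finset V) : ℝ :=
  ∑ v ∈ reach g S, c v

theorem reach_union {V : Type*} [Fintype V] (g : Finset (V × V)) (S T : Finset V) :
    reach g (S ∪ T) = reach g S ∪ reach g T := by
  simp only [reach, Finset.mem_union, or_and_right, exists_or, Finset.filter_or]

theorem reach_mono {V : Type*} [Fintype V] (g : Finset (V × V)) {S T : Finset V} (h : S ⊆ T) :
    reach g S ⊆ reach g T :=
  Finset.monotone_filter_right _ fun _ _ ⟨u, hu, huv⟩ => ⟨u, h hu, huv⟩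

theorem Q'_union_sub {V : Type*} [Fintype V] (g : Finset (V × V)) (c : V → ℝ) (S T : Finset V) :
    Q' g c (S ∪ T) - Q' g c S = ∑ v ∈ reach g T \ reach g S, c v := by
  rw [Q', Q', reach_union, ← Finset.union_sdiff_self_eq_union,
    Finset.sum_union Finset.disjoint_sdiff, add_sub_cancel_left]

/-- For any fixed subgraph `g ⊆ E` and nonnegative vertex weights `c`,
the function `Q'` is submodular. -/
theorem Q'_submodular {V : Type*} [Fintype V]
    (E : Finset (V × V)) (g : Finset (V × V)) (hg : g ⊆ E)
    (c : V → ℝ) (hc : ∀ v, 0 ≤ c v)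
    (M N : Finset V) (hMN : M ⊆ N) (v : V) (hv : v ∉ N) :
    Q' g c (M ∪ {v}) - Q' g c M ≥ Q' g c (N ∪ {v}) - Q' g c N := by
  rw [Q'_union_sub, Q'_union_sub]
  exact Finset.sum_le_sum_of_subset_of_nonneg
    (Finset.sdiff_subset_sdiff le_rfl (reach_mono g hMN)) fun u _ _ => hc u
end
end

section
/- Assume W = Σ_{v∈V} w(v) > 0, and let ρ be the probability distribution on V that picks vertex v with probability w(v)/W, independently of g ∼ μ. Then for every seed set S ⊆ V: δ_U(S) = W · Pr_{g∼μ, v∼ρ}[ S ∩ R_{g^T}(v) ≠ ∅ ]. -/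
open scoped Classical
open Finset

noncomputable section

/-- The transpose graph `g^T`: `(u,v) ∈ g` iff `(v,u) ∈ g^T`. -/
def transpose {V : Type*} (g : Finset (V × V)) : Finset (V × V) := g.image Prod.swap

/-- The vertex weight `w(v) = (1/2)(Σ_{u:(u,v)∈E} A(u,v) + Σ_{u:(v,u)∈E} A(v,u))`. -/
def w {V : Type*} [Fintype V] (E : Finset (V × V)) (A : V × V → ℝ) (v : V) : ℝ :=
  (1 / 2) * ((∑ u ∈ Finset.univ.filter (fun u => (u, v) ∈ E), A (u, v))
    + ∑ u ∈ Finset.univ.filter (fun u => (v, u) ∈ E), A (v, u))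

/-- The upper bound `δ_U(S)`. -/
def deltaU {V : Type*} [Fintype V] (E : Finset (V × V)) (A : V × V → ℝ)
    (μ : Finset (V × V) → ℝ) (S : Finset V) : ℝ :=
  ∑ g ∈ E.powerset, μ g * ∑ v ∈ reach g S, w E A v

theorem mem_transpose {V : Type*} {g : Finset (V × V)} {a b : V} :
    (a, b) ∈ transpose g ↔ (b, a) ∈ g := by
  simp [transpose]

/-- A vertex is reachable from `S` iff its reverse reachable set meets `S`. -/
theorem mem_reach_iff_inter_reach_transpose_nonempty {V : Type*} [Fintype V]
    (g : Finset (V × V)) (S : Finset V) (v : V) :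
    v ∈ reach g S ↔ (S ∩ reach (transpose g) {v}).Nonempty := by
  have reverse (u : V) : Relation.ReflTransGen (fun a b => (a, b) ∈ transpose g) v u ↔
      Relation.ReflTransGen (fun a b => (a, b) ∈ g) u v := by
    simp only [mem_transpose]
    exact Relation.reflTransGen_swap
  simp [reach, Finset.Nonempty, reverse]

/-- `δ_U(S) = W · Pr_{g∼μ, v∼ρ}[S ∩ R_{g^T}(v) ≠ ∅]`, where `ρ` picks vertex `v`
with probability `w(v)/W` and `W = Σ_{v∈V} w(v)`. -/
theorem deltaU_eq_W_mul_prob {V : Type*} [Fintype V]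
    (E : Finset (V × V)) (A : V × V → ℝ) (μ : Finset (V × V) → ℝ)
    (hA : ∀ e ∈ E, 0 ≤ A e) (hA0 : ∀ e ∉ E, A e = 0)
    (hμ : ∀ g ∈ E.powerset, 0 ≤ μ g) (hμ1 : ∑ g ∈ E.powerset, μ g = 1)
    (hW : 0 < ∑ v : V, w E A v)
    (S : Finset V) :
    deltaU E A μ S = (∑ v : V, w E A v) *
      ∑ g ∈ E.powerset, ∑ v ∈ Finset.univ.filter (fun v : V =>
          (S ∩ reach (transpose g) {v}).Nonempty),
        μ g * (w E A v / ∑ u : V, w E A u) := by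
  have hfilter (g : Finset (V × V)) :
      Finset.univ.filter (fun v : V => (S ∩ reach (transpose g) {v}).Nonempty) = reach g S := by
    ext v
    simp [mem_reach_iff_inter_reach_transpose_nonempty]
  simp only [deltaU, hfilter, Finset.mul_sum]
  refine Finset.sum_congr rfl fun g _ => Finset.sum_congr rfl fun v _ => ?_
  rw [mul_left_comm, mul_div_cancel₀ _ hW.ne']
end
end

section
/- (Sandwich approximation.) Let V be a finite type, k ∈ ℕ, and let δ_A, δ_L, δ_U, δ̂_A : Finset V → ℝ be nonnegative functions with δ_L(S) ≤ δ_A(S) ≤ δ_U(S) for all S. Let α, β ∈ [0,1] and γ ∈ [0,1). Let S_A*, S_L*, S_U* be maximizers over k-element sets of δ_A, δ_L, δ_U respectively, and suppose δ_A(S_A*) > 0. Let S_U, S_L, S_A be k-element sets with δ_U(S_U) ≥ α·δ_U(S_U*), δ_U(S_U) > 0, and δ_L(S_L) ≥ β·δ_L(S_L*). Suppose |δ̂_A(S0) − δ_A(S0)| ≤ γ·δ_A(S0) for each S0 ∈ {S_U, S_L, S_A}, and let S be the element of {S_U, S_L, S_A} maximizing δ̂_A. Then δ_A(S) ≥ max{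 (δ_A(S_U)/δ_U(S_U))·α , (δ_L(S_L*)/δ_A(S_A*))·β } · ((1−γ)/(1+γ)) · δ_A(S_A*). -/
open Finset

/-- The sandwich approximation guarantee. -/
theorem sandwich_approximation {V : Type*} (k : ℕ)
    (dA dL dU dAhat : Finset V → ℝ)
    (h0A : ∀ S, 0 ≤ dA S) (h0L : ∀ S, 0 ≤ dL S)
    (h0U : ∀ S, 0 ≤ dU S) (h0hat : ∀ S, 0 ≤ dAhat S)
    (hLA : ∀ S, dL S ≤ dA S) (hAU : ∀ S, dA S ≤ dU S)
    (α β γ : ℝ) (hα : α ∈ Set.Icc (0 : ℝ) 1) (hβ : β ∈ Set.Icc (0 : ℝ) 1)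
    (hγ : γ ∈ Set.Ico (0 : ℝ) 1)
    (SAstar SLstar SUstar : Finset V)
    (hcAstar : SAstar.card = k) (hAmax : ∀ S : Finset V, S.card = k → dA S ≤ dA SAstar)
    (hcLstar : SLstar.card = k) (hLmax : ∀ S : Finset V, S.card = k → dL S ≤ dL SLstar)
    (hcUstar : SUstar.card = k) (hUmax : ∀ S : Finset V, S.card = k → dU S ≤ dU SUstar)
    (hApos : 0 < dA SAstar)
    (SU SL SA : Finset V)
    (hcU : SU.card = k) (hcL : SL.card = k) (hcA : SA.card = k)
    (hUapprox : dU SU ≥ α * dU SUstar) (hUpos : 0 < dU SU)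
    (hLapprox : dL SL ≥ β * dL SLstar)
    (herrU : |dAhat SU - dA SU| ≤ γ * dA SU)
    (herrL : |dAhat SL - dA SL| ≤ γ * dA SL)
    (herrA : |dAhat SA - dA SA| ≤ γ * dA SA)
    (S : Finset V) (hS : S = SU ∨ S = SL ∨ S = SA)
    (hSmax : dAhat SU ≤ dAhat S ∧ dAhat SL ≤ dAhat S ∧ dAhat SA ≤ dAhat S) :
    dA S ≥ max ((dA SU / dU SU) * α) ((dL SLstar / dA SAstar) * β) *
      ((1 - γ) / (1 + γ)) * dA SAstar := by
  have hγ1 : 0 < 1 + γ := by linarith [hγ.1]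
  have hSerr : |dAhat S - dA S| ≤ γ * dA S := by
    rcases hS with rfl | rfl | rfl <;> assumption
  have transfer : ∀ T c, |dAhat T - dA T| ≤ γ * dA T → dAhat T ≤ dAhat S →
      c * dA SAstar ≤ dA T → c * ((1 - γ) / (1 + γ)) * dA SAstar ≤ dA S := by
    intro T c hT hle hc
    have hratio : c * ((1 - γ) / (1 + γ)) * dA SAstar =
        (1 - γ) * (c * dA SAstar) / (1 + γ) := by ring
    rw [hratio, div_le_iff₀ hγ1]
    have hmul := mul_le_mul_of_nonneg_left hc (sub_nonneg.2 hγ.2.le)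
    linarith [(abs_le.1 hT).1, (abs_le.1 hSerr).2]
  rcases max_choice ((dA SU / dU SU) * α) ((dL SLstar / dA SAstar) * β) with h | h <;> rw [h]
  · refine transfer SU _ herrU hSmax.1 ?_
    have hbound : α * dA SAstar ≤ dU SU :=
      (mul_le_mul_of_nonneg_left ((hAU _).trans (hUmax _ hcAstar)) hα.1).trans hUapprox
    calc dA SU / dU SU * α * dA SAstar = dA SU / dU SU * (α * dA SAstar) := by ring
      _ ≤ dA SU / dU SU * dU SU :=
        mul_le_mul_of_nonneg_left hbound (div_nonneg (h0A _) (h0U _))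
      _ = dA SU := div_mul_cancel₀ _ hUpos.ne'
  · refine transfer SL _ herrL hSmax.2.1 ?_
    calc dL SLstar / dA SAstar * β * dA SAstar = β * dL SLstar := by field_simp
      _ ≤ dL SL := hLapprox
      _ ≤ dA SL := hLA SL
end

section
/- (Correctness of the set cover reduction.) Let n, m, k ∈ ℕ and let S : Fin m → Finset (Fin n) satisfy ⋃_i S_i = Fin n. Build a graph on the vertex type W = Fin m ⊕ Fin n ⊕ Fin n, writing x_i, y_j, y'_j for the three kinds of vertices; diffusion is deterministic with R(T) = T ∪ {y_j : ∃ i with x_i ∈ T and j ∈ S_i} ∪ {y'_j : ∃ i with x_i ∈ T and j ∈ S_i}, and the activity of a seed set T ⊆ W is δ(T) = |{j ∈ Fin n : y_j ∈ R(T) and y'_j ∈ R(T)}|. Then there exists a seed set T ⊆ W with |T| ≤ k and δ(T) = n if and only if there exists I ⊆ Fin m with |I| ≤ k and ⋃_{i∈I} S_i = Fin n. -/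
open scoped Classical
open Finset

noncomputable section

/-- In the set cover reduction graph on `Fin m ⊕ Fin n ⊕ Fin n`
(vertices `x i = .inl i`, `y j = .inr (.inl j)`, `y' j = .inr (.inr j)`),
the set of active nodes reached from a seed set `T` by the deterministic diffusion:
`T` itself together with all `y j` and `y' j` such that some seeded `x i` has `j ∈ S i`. -/
def reached (n m : ℕ) (S : Fin m → Finset (Fin n))
    (T : Finset (Fin m ⊕ Fin n ⊕ Fin n)) : Finset (Fin m ⊕ Fin n ⊕ Fin n) :=
  T ∪ ((Finset.univ.filter (fun j : Fin n => ∃ i : Fin m, Sum.inl i ∈ T ∧ j ∈ S i)).image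
        (fun j => Sum.inr (Sum.inl j)))
    ∪ ((Finset.univ.filter (fun j : Fin n => ∃ i : Fin m, Sum.inl i ∈ T ∧ j ∈ S i)).image
        (fun j => Sum.inr (Sum.inr j)))

/-- The activity of a seed set `T` in the reduction graph: the number of elements `j`
with both `y j` and `y' j` active. -/
def delta (n m : ℕ) (S : Fin m → Finset (Fin n))
    (T : Finset (Fin m ⊕ Fin n ⊕ Fin n)) : ℕ :=
  (Finset.univ.filter (fun j : Fin n =>
    Sum.inr (Sum.inl j) ∈ reached n m S T ∧
    Sum.inr (Sum.inr j) ∈ reached n m S T)).card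

theorem inl_mem_reached {n m : ℕ} {S : Fin m → Finset (Fin n)}
    {T : Finset (Fin m ⊕ Fin n ⊕ Fin n)} {j : Fin n} :
    Sum.inr (Sum.inl j) ∈ reached n m S T ↔
      Sum.inr (Sum.inl j) ∈ T ∨ ∃ i, Sum.inl i ∈ T ∧ j ∈ S i := by
  simp [reached]

theorem inr_mem_reached {n m : ℕ} {S : Fin m → Finset (Fin n)}
    {T : Finset (Fin m ⊕ Fin n ⊕ Fin n)} {j : Fin n} :
    Sum.inr (Sum.inr j) ∈ reached n m S T ↔
      Sum.inr (Sum.inr j) ∈ T ∨ ∃ i, Sum.inl i ∈ T ∧ j ∈ S i := by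
  simp [reached]

theorem delta_eq_iff {n m : ℕ} {S : Fin m → Finset (Fin n)}
    {T : Finset (Fin m ⊕ Fin n ⊕ Fin n)} :
    delta n m S T = n ↔ ∀ j : Fin n,
      Sum.inr (Sum.inl j) ∈ reached n m S T ∧ Sum.inr (Sum.inr j) ∈ reached n m S T := by
  rw [delta]
  conv_lhs => rhs; rw [← Finset.card_fin n]
  simp only [Finset.card_filter_eq_iff, Finset.mem_univ, true_imp_iff]

/-- Correctness of the set cover reduction: there is a seed set of size at most `k`
achieving activity `n` iff there is a set cover of size at most `k`. -/
theorem setCover_reduction_correct (n m k : ℕ) (S : Fin m → Finset (Fin n))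
    (hcover : ∀ j : Fin n, ∃ i : Fin m, j ∈ S i) :
    (∃ T : Finset (Fin m ⊕ Fin n ⊕ Fin n), T.card ≤ k ∧ delta n m S T = n) ↔
    (∃ I : Finset (Fin m), I.card ≤ k ∧ ∀ j : Fin n, ∃ i ∈ I, j ∈ S i) := by
  constructor
  · rintro ⟨T, hT, hδ⟩
    choose c hc using hcover
    refine ⟨T.image (Sum.elim id (Sum.elim c c)), Finset.card_image_le.trans hT, fun j => ?_⟩
    obtain hj | ⟨i, hi, hj⟩ := inl_mem_reached.1 (delta_eq_iff.1 hδ j).1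
    · exact ⟨c j, Finset.mem_image.2 ⟨_, hj, rfl⟩, hc j⟩
    · exact ⟨i, Finset.mem_image.2 ⟨_, hi, rfl⟩, hj⟩
  · rintro ⟨I, hI, hcov⟩
    refine ⟨I.image Sum.inl, Finset.card_image_le.trans hI, delta_eq_iff.2 fun j => ?_⟩
    obtain ⟨i, hi, hj⟩ := hcov j
    have h : ∃ i, Sum.inl i ∈ I.image (Sum.inl : Fin m → Fin m ⊕ Fin n ⊕ Fin n) ∧ j ∈ S i :=
      ⟨i, Finset.mem_image_of_mem _ hi, hj⟩
    exact ⟨inl_mem_reached.2 (.inr h), inr_mem_reached.2 (.inr h)⟩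
end
end

section
/- (Pendant augmentation identity.) Let G = (V, E) be a finite directed graph with live-edge distribution μ and activity A ≡ 1 on E. Form G' on the vertex type V ⊕ V with edge set E' = E ∪ {(v, v') : v ∈ V}, where v' denotes the pendant copy of v; let μ' be the pushforward of μ that makes every pendant edge (v, v') live, i.e., μ' puts the mass μ(g) on g ∪ {(v,v') : v ∈ V}, and give every pendant edge activity 1. Then for every seed set S ⊆ V (embedded in the left copy): δ_A^{G'}(S) = δ_A^{G}(S) + E_{g∼μ}[ |R_g(S)| ]; in particular the difference of the two activities is the expected number of active nodes (the influence spread) of S in G. -/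
open scoped Classical
open Finset

noncomputable section

/-- Embedding of the edges of `G` into the augmented graph `G'` on `V ⊕ V`. -/
def emb {V : Type*} : V × V → (V ⊕ V) × (V ⊕ V) :=
  fun e => (Sum.inl e.1, Sum.inl e.2)

/-- The pendant edges `(v, v')` of the augmented graph, from each original node `v`
to its pendant copy `v'`. -/
def pendants (V : Type*) [Fintype V] : Finset ((V ⊕ V) × (V ⊕ V)) :=
  Finset.univ.image (fun v : V => (Sum.inl v, Sum.inr v))

theorem mem_reach_iff {V : Type*} [Fintype V] {g : Finset (V × V)} {S : Finset V} {v : V} :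
    v ∈ reach g S ↔ ∃ u ∈ S, Relation.ReflTransGen (fun a b => (a, b) ∈ g) u v := by
  simp [reach]

theorem emb_injective {V : Type*} : Function.Injective (emb : V × V → _) := by
  rintro ⟨a, b⟩ ⟨c, d⟩ h
  simpa [emb] using h

theorem inl_inl_mem_augmented {V : Type*} [Fintype V] {g : Finset (V × V)} {a b : V} :
    (Sum.inl a, Sum.inl b) ∈ g.image emb ∪ pendants V ↔ (a, b) ∈ g := by
  simp [emb, pendants]

theorem inl_inr_mem_augmented {V : Type*} [Fintype V] {g : Finset (V × V)} {a b : V} :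
    (Sum.inl a, Sum.inr b) ∈ g.image emb ∪ pendants V ↔ a = b := by
  simp [emb, pendants]

theorem inr_notMem_augmented {V : Type*} [Fintype V] {g : Finset (V × V)} {a : V} {y : V ⊕ V} :
    (Sum.inr a, y) ∉ g.image emb ∪ pendants V := by
  simp [emb, pendants]

/-- Any vertex reachable in the augmented graph from an original vertex `u` projects to a
vertex reachable from `u` in the original graph. -/
theorem reflTransGen_of_augmented {V : Type*} [Fintype V] {g : Finset (V × V)} {u : V}
    {x : V ⊕ V}
    (h : Relation.ReflTransGen (fun a b => (a, b) ∈ g.image emb ∪ pendants V) (Sum.inl u) x) :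
    Relation.ReflTransGen (fun a b => (a, b) ∈ g) u (Sum.elim id id x) := by
  induction h with
  | refl => exact .refl
  | @tail y z _ hyz ih =>
    rcases y with y | y
    · rcases z with z | z
      · exact ih.tail (inl_inl_mem_augmented.1 hyz)
      · obtain rfl := inl_inr_mem_augmented.1 hyz
        exact ih
    · exact absurd hyz inr_notMem_augmented

theorem mem_reach_augmented {V : Type*} [Fintype V] {g : Finset (V × V)} {S : Finset V}
    {x : V ⊕ V} :
    x ∈ reach (g.image emb ∪ pendants V) (S.image Sum.inl) ↔ Sum.elim id id x ∈ reach g S := by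
  simp only [mem_reach_iff, Finset.exists_mem_image]
  refine exists_congr fun u => and_congr_right fun _ => ⟨reflTransGen_of_augmented, fun h => ?_⟩
  have key : ∀ v, Relation.ReflTransGen (fun a b => (a, b) ∈ g) u v →
      Relation.ReflTransGen (fun a b => (a, b) ∈ g.image emb ∪ pendants V)
        (Sum.inl u) (Sum.inl v) := fun v hv =>
    hv.lift Sum.inl fun a b hab => inl_inl_mem_augmented.2 hab
  rcases x with v | v
  · exact key v h
  · exact (key v h).tail (inl_inr_mem_augmented.2 rfl)

/-- For a fixed live-edge graph, the active edges of the augmented graph are the active edges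
of the original one together with one pendant edge for each active node. -/
theorem card_active_edges_augmented {V : Type*} [Fintype V] (E g : Finset (V × V))
    (S : Finset V) :
    ((E.image emb ∪ pendants V).filter (fun e =>
        e.1 ∈ reach (g.image emb ∪ pendants V) (S.image Sum.inl) ∧
        e.2 ∈ reach (g.image emb ∪ pendants V) (S.image Sum.inl))).card
      = (E.filter (fun e => e.1 ∈ reach g S ∧ e.2 ∈ reach g S)).card + (reach g S).card := by
  simp only [mem_reach_augmented]
  rw [filter_union, card_union_of_disjoint, filter_image, card_image_of_injective _ emb_injective,
    pendants, filter_image, card_image_of_injective]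
  · simp only [emb, Sum.elim_inl, Sum.elim_inr, id_eq, and_self, filter_univ_mem]
    congr!
  · intro a b h
    simpa using h
  · refine (disjoint_left.2 fun e he hp => ?_).mono (filter_subset _ _) (filter_subset _ _)
    obtain ⟨a, _, rfl⟩ := mem_image.1 he
    simp [emb, pendants] at hp

/-- Pendant augmentation identity: with activity `1` on every edge, adding a pendant
neighbor to each node (with always-live pendant edges carrying activity `1`) increases
the activity of every seed set by exactly the influence spread, i.e.
`δ_A^{G'}(S) = δ_A^{G}(S) + E_{g∼μ}[|R_g(S)|]`. -/
theorem pendant_augmentation_identity {V : Type*} [Fintype V]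
    (E : Finset (V × V)) (μ : Finset (V × V) → ℝ)
    (hμ : ∀ g ∈ E.powerset, 0 ≤ μ g) (hμ1 : ∑ g ∈ E.powerset, μ g = 1)
    (S : Finset V) :
    (∑ g ∈ E.powerset, μ g *
        (((E.image emb ∪ pendants V).filter (fun e =>
            e.1 ∈ reach (g.image emb ∪ pendants V) (S.image Sum.inl) ∧
            e.2 ∈ reach (g.image emb ∪ pendants V) (S.image Sum.inl))).card : ℝ))
    = (∑ g ∈ E.powerset, μ g *
        ((E.filter (fun e => e.1 ∈ reach g S ∧ e.2 ∈ reach g S)).card : ℝ))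
      + ∑ g ∈ E.powerset, μ g * ((reach g S).card : ℝ) := by
  simp only [card_active_edges_augmented, Nat.cast_add, mul_add, sum_add_distrib]
end
end
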